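/- Let E be a finite-dimensional real vector space given as an internal direct sum E = V₁ ⊕ ⋯ ⊕ V_ι of subspaces, with associated projections π_j : E → V_j, and set F_j = V₁ ⊕ ⋯ ⊕ V_j (with F₀ = 0). Let W ⊆ E be a subspace and W_j = W ∩ F_j. Suppose that for each j ∈ {1,…,ι} we are given vectors t^j_1, …, t^j_{m_j} ∈ W_j whose images in the quotient W_j / W_{j−1} are linearly independent. Then the whole family { π_j(t^j_i) : 1 ≤ j ≤ ι, 1 ≤ i ≤ m_j } is linearly independent in E. -/

import Mathlib

/-- A linear map that is the identity on `V j` and kills the other summands takes values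
in `V j`. -/
lemma apply_mem_of_iSup_eq_top {R E κ : Type*} [Ring R] [AddCommGroup E] [Module R E]
    {V : κ → Submodule R E} (hV : ⨆ k, V k = ⊤) {j : κ} {p : E →ₗ[R] E}
    (hp₁ : ∀ x ∈ V j, p x = x) (hp₂ : ∀ k, j ≠ k → ∀ x ∈ V k, p x = 0) (x : E) :
    p x ∈ V j := by
  have h : ⨆ k, V k ≤ (V j).comap p := iSup_le fun k y hy => by
    rw [Submodule.mem_comap]
    rcases eq_or_ne j k with rfl | hk
    · rwa [hp₁ y hy]
    · rw [hp₂ k hk y hy]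
      exact zero_mem _
  exact h (hV ▸ Submodule.mem_top)

/-- Subtracting the `V j`-component of a vector of the `j`-th step of the flag lands in the
preceding step. -/
lemma sub_apply_mem_iSup_lt {R E κ : Type*} [Ring R] [AddCommGroup E] [Module R E]
    [PartialOrder κ] {V : κ → Submodule R E} {j : κ} {p : E →ₗ[R] E}
    (hp₁ : ∀ x ∈ V j, p x = x) (hp₂ : ∀ k, j ≠ k → ∀ x ∈ V k, p x = 0) {x : E}
    (hx : x ∈ ⨆ (k : κ) (_ : k ≤ j), V k) :
    x - p x ∈ ⨆ (k : κ) (_ : k < j), V k := by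
  have h : ⨆ (k : κ) (_ : k ≤ j), V k ≤
      (⨆ (k : κ) (_ : k < j), V k).comap (LinearMap.id - p) :=
    iSup₂_le fun k hk y hy => by
      rw [Submodule.mem_comap, LinearMap.sub_apply, LinearMap.id_apply]
      rcases hk.eq_or_lt with rfl | hlt
      · rw [hp₁ y hy, sub_self]
        exact zero_mem _
      · rw [hp₂ k hlt.ne' y hy, sub_zero]
        exact Submodule.mem_iSup_of_mem k (Submodule.mem_iSup_of_mem hlt hy)
  exact h hx

/-- Let `E = V₁ ⊕ ⋯ ⊕ V_ι` be an internal direct sum with projections `π j`,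
`F_j = V₁ ⊕ ⋯ ⊕ V_j` the associated flag, `W` a subspace and `W_j = W ∩ F_j`. If for each `j`
the vectors `t^j_1, …, t^j_{m_j} ∈ W_j` have linearly independent images modulo `W_{j-1}`,
then the whole family `π_j (t^j_i)` is linearly independent. -/
theorem projections_of_flag_adapted_vectors_linearIndependent
    {E : Type*} [AddCommGroup E] [Module ℝ E] [FiniteDimensional ℝ E]
    (ι : ℕ) (V : Fin ι → Submodule ℝ E) (hV : DirectSum.IsInternal V)
    (π : Fin ι → E →ₗ[ℝ] E)
    (hπ₁ : ∀ j : Fin ι, ∀ x ∈ V j, π j x = x)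
    (hπ₂ : ∀ j k : Fin ι, j ≠ k → ∀ x ∈ V k, π j x = 0)
    (W : Submodule ℝ E) (m : Fin ι → ℕ)
    (t : (j : Fin ι) → Fin (m j) → E)
    (ht : ∀ (j : Fin ι) (i : Fin (m j)),
      t j i ∈ W ⊓ ⨆ (i' : Fin ι) (_ : i' ≤ j), V i')
    (hind : ∀ j : Fin ι,
      LinearIndependent ℝ
        (fun i : Fin (m j) =>
          (W ⊓ ⨆ (i' : Fin ι) (_ : i' < j), V i').mkQ (t j i))) :
    LinearIndependent ℝ
      (fun p : (Σ j : Fin ι, Fin (m j)) => π p.1 (t p.1 p.2)) := by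
  have hmem (j : Fin ι) (x : E) : π j x ∈ V j :=
    apply_mem_of_iSup_eq_top hV.submodule_iSup_eq_top (hπ₁ j) (hπ₂ j) x
  rw [Fintype.linearIndependent_iff]
  rintro g hg ⟨k, i⟩
  let s (j : Fin ι) : E := ∑ i, g ⟨j, i⟩ • t j i
  have hsum : ∑ j, π j (s j) = 0 := by
    rw [Fintype.sum_sigma] at hg
    simpa only [s, map_sum, map_smul] using hg
  have hk : π k (s k) = 0 := by
    have h := congrArg (π k) hsum
    rwa [map_sum, map_zero, Fintype.sum_eq_single k
      (fun j hj => hπ₂ k j hj.symm _ (hmem j _)), hπ₁ k _ (hmem k _)] at h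
  have hs : s k ∈ W ⊓ ⨆ (i' : Fin ι) (_ : i' ≤ k), V i' :=
    Submodule.sum_mem _ fun i _ => Submodule.smul_mem _ _ (ht k i)
  have hlt : s k ∈ W ⊓ ⨆ (i' : Fin ι) (_ : i' < k), V i' := by
    refine ⟨hs.1, ?_⟩
    simpa only [hk, sub_zero, SetLike.mem_coe] using sub_apply_mem_iSup_lt (hπ₁ k) (hπ₂ k) hs.2
  refine Fintype.linearIndependent_iff.mp (hind k) (fun i => g ⟨k, i⟩) ?_ i
  simp only [← map_smul, ← map_sum]
  exact (Submodule.Quotient.mk_eq_zero _).mpr hlt
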